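/- arXiv:math/9608210 — 5 statements merged into one kernel-verified Lean document; each statement's English description precedes it below -/
import Mathlib

section
/- Let Γ be a group of isometries of the hyperbolic plane ℍ acting properly discontinuously, let c : ℝ → ℍ be an isometric embedding with image A, and let g ∈ Γ and ℓ > 0 satisfy g(c(t)) = c(t + ℓ) for all t ∈ ℝ. Set z = c(0) and q = c(ℓ/2). Assume: (i) the stabilizer {γ ∈ Γ : γ(A) = A} is exactly the cyclic group generated by g; (ii) there is δ > ℓ/4 such that dist(γ(z), A) ≥ 2δ for every γ ∈ Γ with γ(A) ≠ A. Then q lies in the Dirichlet domain of Γ centered at z: dist(q, z) ≤ dist(q, γ(z)) for every γ ∈ Γ, and the inequality is strict unless γ is the identity or γ = g. -/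
open Pointwise

/-- (Lemma 3.2 restricted to the invariant real hyperbolic plane.)
If the stabilizer of the axis `A` is exactly the cyclic group generated by the
hyperbolic element `g` of translation length `ℓ`, and for some `δ > ℓ/4` every
`γ ∈ Γ` not stabilizing `A` moves the center `z = c(0)` at distance `≥ 2δ` from
`A`, then the midpoint `q = c(ℓ/2)` lies in the Dirichlet domain `D_z(Γ)`,
with strict inequalities except for `γ = 1` and `γ = g`. -/
theorem dirichlet_two_sides
    (Γ : Type*) [Group Γ] [MulAction Γ UpperHalfPlane]
    (hiso : ∀ (γ : Γ) (x y : UpperHalfPlane), dist (γ • x) (γ • y) = dist x y)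
    [ProperlyDiscontinuousSMul Γ UpperHalfPlane]
    (c : ℝ → UpperHalfPlane) (hc : Isometry c)
    (A : Set UpperHalfPlane) (hA : A = Set.range c)
    (g : Γ) (ℓ : ℝ) (hℓ : 0 < ℓ)
    (hg : ∀ t : ℝ, g • c t = c (t + ℓ))
    (hstab : ∀ γ : Γ, γ • A = A ↔ γ ∈ Subgroup.zpowers g)
    (δ : ℝ) (hδ : δ > ℓ / 4)
    (hfar : ∀ γ : Γ, γ • A ≠ A → Metric.infDist (γ • c 0) A ≥ 2 * δ) :
    ∀ γ : Γ, dist (c (ℓ / 2)) (c 0) ≤ dist (c (ℓ / 2)) (γ • c 0) ∧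
      (γ ≠ 1 → γ ≠ g → dist (c (ℓ / 2)) (c 0) < dist (c (ℓ / 2)) (γ • c 0)) := by
  intro γ
  have hd : ∀ s t : ℝ, dist (c s) (c t) = |s - t| := fun s t => by
    rw [hc.dist_eq, Real.dist_eq]
  have h0 : dist (c (ℓ / 2)) (c 0) = ℓ / 2 := by
    rw [hd, sub_zero, abs_of_pos (by linarith)]
  by_cases h : γ • A = A
  · obtain ⟨n, rfl⟩ := Subgroup.mem_zpowers_iff.1 ((hstab γ).1 h)
    have hpow : ∀ (k : ℕ) (t : ℝ), g ^ k • c t = c (t + k * ℓ) := by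
      intro k
      induction k with
      | zero => intro t; simp
      | succ k ih =>
        intro t
        rw [pow_succ, mul_smul, hg, ih]
        congr 1
        push_cast
        ring
    have hz : g ^ n • c 0 = c (n * ℓ) := by
      obtain ⟨k, rfl | rfl⟩ := n.eq_nat_or_neg
      · rw [zpow_natCast, hpow]
        simp
      · rw [zpow_neg, zpow_natCast, inv_smul_eq_iff, hpow]
        congr 1
        push_cast
        ring
    rw [h0, hz, hd]
    rcases lt_trichotomy n 0 with hn | rfl | hn
    · have h1 : (n : ℝ) ≤ -1 := by exact_mod_cast Int.le_sub_one_of_lt hn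
      have h2 : ℓ / 2 < |ℓ / 2 - n * ℓ| := lt_of_lt_of_le (by nlinarith) (le_abs_self _)
      exact ⟨h2.le, fun _ _ => h2⟩
    · refine ⟨?_, fun h1 => absurd (zpow_zero g) h1⟩
      simpa using le_abs_self (ℓ / 2)
    · rcases (show n = 1 ∨ 2 ≤ n by omega) with rfl | hn
      · refine ⟨?_, fun _ h1 => absurd (zpow_one g) h1⟩
        refine le_trans (le_of_eq ?_) (neg_le_abs _)
        push_cast
        ring
      · have h1 : (2 : ℝ) ≤ n := by exact_mod_cast hn
        have h2 : ℓ / 2 < |ℓ / 2 - n * ℓ| := lt_of_lt_of_le (by nlinarith) (neg_le_abs _)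
        exact ⟨h2.le, fun _ _ => h2⟩
  · have h1 := hfar γ h
    have h2 : Metric.infDist (γ • c 0) A ≤ dist (γ • c 0) (c (ℓ / 2)) :=
      Metric.infDist_le_dist_of_mem (hA ▸ Set.mem_range_self _)
    rw [dist_comm] at h2
    have h3 : dist (c (ℓ / 2)) (c 0) < dist (c (ℓ / 2)) (γ • c 0) := by linarith
    exact ⟨h3.le, fun _ _ => h3⟩
end

section
/- Let ℓ > 0 be a real number with sinh(ℓ/2) < 1/(2·sinh((ln 63)/4)). Then: (a) (ln 63)/4 ≤ 2·arsinh(1/(2·sinh(ℓ/4))), so that real numbers δ with (ln 63)/4 ≤ δ ≤ 2·arsinh(1/(2·sinh(ℓ/4))) exist; and (b) every such δ satisfies both sinh(ℓ/4)·sinh(δ/2) ≤ 1/2 and ℓ < 4δ. -/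
/-- (Remark 3.5, corrected form.) If `sinh(ℓ/2) < 1/(2 sinh((ln 63)/4))`,
then `(ln 63)/4 ≤ 2 arsinh(1/(2 sinh(ℓ/4)))`, and every `δ` in that range satisfies
both `sinh(ℓ/4)·sinh(δ/2) ≤ 1/2` and `ℓ < 4δ`. -/
theorem remark_3_5 (ℓ : ℝ) (hℓ : 0 < ℓ)
    (h : Real.sinh (ℓ / 2) < 1 / (2 * Real.sinh (Real.log 63 / 4))) :
    Real.log 63 / 4 ≤ 2 * Real.arsinh (1 / (2 * Real.sinh (ℓ / 4))) ∧
      ∀ δ : ℝ, Real.log 63 / 4 ≤ δ → δ ≤ 2 * Real.arsinh (1 / (2 * Real.sinh (ℓ / 4))) →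
        Real.sinh (ℓ / 4) * Real.sinh (δ / 2) ≤ 1 / 2 ∧ ℓ < 4 * δ := by
  have hlog : (2 : ℝ) ≤ Real.log 63 := by
    rw [Real.le_log_iff_exp_le (by norm_num)]
    have h1 := Real.exp_one_lt_d9
    have h0 := Real.exp_pos 1
    have h2 : Real.exp 2 = Real.exp 1 * Real.exp 1 := by
      rw [← Real.exp_add]; norm_num
    rw [h2]
    nlinarith
  obtain ⟨a, ha⟩ : ∃ a, a = Real.log 63 / 4 := ⟨_, rfl⟩
  rw [← ha] at h ⊢
  have ha2 : 1 / 2 ≤ a := by linarith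
  have hsa : a ≤ Real.sinh a := Real.self_le_sinh_iff.2 (by linarith)
  have hs4 : 0 < Real.sinh (ℓ / 4) := Real.sinh_pos_iff.2 (by linarith)
  have hs42 : Real.sinh (ℓ / 4) ≤ Real.sinh (ℓ / 2) := Real.sinh_le_sinh.2 (by linarith)
  have hsa2 : Real.sinh (a / 2) ≤ Real.sinh a := Real.sinh_le_sinh.2 (by linarith)
  have hsap : 0 < Real.sinh (a / 2) := Real.sinh_pos_iff.2 (by linarith)
  have hprod : Real.sinh (ℓ / 2) * (2 * Real.sinh a) < 1 := by
    rwa [lt_div_iff₀ (by linarith)] at h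
  refine ⟨?_, fun δ h1 h2 => ⟨?_, ?_⟩⟩
  · have : a / 2 ≤ Real.arsinh (1 / (2 * Real.sinh (ℓ / 4))) := by
      rw [← Real.sinh_le_sinh, Real.sinh_arsinh, le_div_iff₀ (by linarith)]
      have := mul_le_mul hsa2 hs42 hs4.le (by linarith)
      nlinarith
    linarith
  · have : δ / 2 ≤ Real.arsinh (1 / (2 * Real.sinh (ℓ / 4))) := by linarith
    rw [← Real.sinh_le_sinh, Real.sinh_arsinh, le_div_iff₀ (by linarith)] at this
    linarith
  · by_contra hc
    have h3 : ℓ / 2 ≤ Real.sinh (ℓ / 2) := Real.self_le_sinh_iff.2 (by linarith)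
    have h4 : 1 ≤ Real.sinh (ℓ / 2) := by linarith
    nlinarith
end

section
/- For parameters 0 < ζ < π/2 and 0 ≤ η < π − 2ζ, the bending map φ_{η,ζ} : ℂ → ℂ is a homeomorphism of ℂ onto itself: it is continuous, bijective, and its inverse is continuous. -/
open Real

/-- The bending homeomorphism `φ_{η,ζ} : ℂ → ℂ` of (4.2), with `arg` taking
values in `(−π, π]`: it fixes the sector `|arg z| ≥ π − ζ`, rotates the sector
`|arg z| ≤ ζ` by the angle `η`, and interpolates linearly in the argument on
the two intermediate sectors. -/
noncomputable def bendingMap (η ζ : ℝ) (z : ℂ) : ℂ :=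
  if π - ζ ≤ |Complex.arg z| then z
  else if |Complex.arg z| ≤ ζ then z * Complex.exp (Complex.I * (η : ℂ))
  else if 0 < Complex.arg z then
    z * Complex.exp (Complex.I * ((η * (1 - (Complex.arg z - ζ) / (π - 2 * ζ)) : ℝ) : ℂ))
  else
    z * Complex.exp (Complex.I * ((η * (1 + (Complex.arg z + ζ) / (π - 2 * ζ)) : ℝ) : ℂ))

/-- The rotation angle as a function of `t = |arg z|`. -/
noncomputable def bendAngle (η ζ t : ℝ) : ℝ :=
  η * max 0 (min 1 (1 - (t - ζ) / (π - 2 * ζ)))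

lemma bendAngle_continuous (η ζ : ℝ) : Continuous (bendAngle η ζ) := by
  unfold bendAngle
  fun_prop

lemma bendAngle_nonneg {η ζ : ℝ} (hη0 : 0 ≤ η) (t : ℝ) : 0 ≤ bendAngle η ζ t :=
  mul_nonneg hη0 (le_max_left _ _)

lemma bendAngle_pi {η ζ : ℝ} (hζ0 : 0 < ζ) (hζ : ζ < π / 2) : bendAngle η ζ π = 0 := by
  have hD : 0 < π - 2 * ζ := by linarith
  have h : 1 - (π - ζ) / (π - 2 * ζ) ≤ 0 := by
    rw [sub_nonpos, le_div_iff₀ hD]; linarith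
  unfold bendAngle
  rw [max_eq_left ((min_le_right _ _).trans h), mul_zero]

lemma bendingMap_eq {η ζ : ℝ} (hζ0 : 0 < ζ) (hζ : ζ < π / 2) (z : ℂ) :
    bendingMap η ζ z = z * Complex.exp ((bendAngle η ζ |Complex.arg z| : ℝ) * Complex.I) := by
  have hD : 0 < π - 2 * ζ := by linarith
  unfold bendingMap bendAngle
  split_ifs with h1 h2 h3
  · have h : 1 - (|Complex.arg z| - ζ) / (π - 2 * ζ) ≤ 0 := by
      rw [sub_nonpos, le_div_iff₀ hD]; linarith
    rw [max_eq_left ((min_le_right _ _).trans h)]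
    simp
  · have h : (|Complex.arg z| - ζ) / (π - 2 * ζ) ≤ 0 :=
      div_nonpos_of_nonpos_of_nonneg (by linarith) hD.le
    rw [min_eq_left (by linarith), max_eq_right zero_le_one, mul_one, mul_comm Complex.I]
  all_goals
    have ha : 0 ≤ (|Complex.arg z| - ζ) / (π - 2 * ζ) := div_nonneg (by linarith) hD.le
    have hb : (|Complex.arg z| - ζ) / (π - 2 * ζ) ≤ 1 := by
      rw [div_le_one hD]; linarith
    rw [min_eq_right (by linarith), max_eq_right (by linarith), mul_comm Complex.I]
  · rw [abs_of_pos h3]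
  · rw [abs_of_nonpos (not_lt.mp h3)]
    congr 5
    ring

lemma clamp_lip (a b : ℝ) : |max 0 (min 1 a) - max 0 (min 1 b)| ≤ |a - b| := by
  refine (abs_max_sub_max_le_max 0 _ 0 _).trans ?_
  refine max_le (by simp) ((abs_min_sub_min_le_max 1 _ 1 _).trans (max_le (by simp) le_rfl))

lemma bendAngle_lip {η ζ : ℝ} (hζ : ζ < π / 2) (hη0 : 0 ≤ η) (hη : η < π - 2 * ζ)
    {s t : ℝ} (hst : s ≠ t) : |bendAngle η ζ s - bendAngle η ζ t| < |s - t| := by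
  have hD : 0 < π - 2 * ζ := by linarith
  have key : |max 0 (min 1 (1 - (s - ζ) / (π - 2 * ζ))) -
      max 0 (min 1 (1 - (t - ζ) / (π - 2 * ζ)))| ≤ |s - t| / (π - 2 * ζ) := by
    have e : |s - t| / (π - 2 * ζ) =
        |(1 - (s - ζ) / (π - 2 * ζ)) - (1 - (t - ζ) / (π - 2 * ζ))| := by
      rw [← abs_of_pos hD, ← abs_div, abs_of_pos hD, ← abs_neg]
      congr 1
      ring
    rw [e]
    exact clamp_lip _ _
  unfold bendAngle
  rw [← mul_sub, abs_mul, abs_of_nonneg hη0]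
  have hp : 0 < |s - t| := abs_pos.mpr (sub_ne_zero.mpr hst)
  calc _ ≤ η * (|s - t| / (π - 2 * ζ)) := by gcongr
    _ = |s - t| * (η / (π - 2 * ζ)) := by ring
    _ < |s - t| * 1 := by
      gcongr
      rwa [div_lt_one hD]
    _ = _ := mul_one _

lemma bendArg_strictMono {η ζ : ℝ} (hζ : ζ < π / 2) (hη0 : 0 ≤ η) (hη : η < π - 2 * ζ) :
    StrictMono (fun θ : ℝ => θ + bendAngle η ζ |θ|) := by
  intro a b hab
  simp only
  by_cases h : |a| = |b|
  · rw [h]; linarith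
  · have h1 := bendAngle_lip hζ hη0 hη h
    have h2 := abs_abs_sub_abs_le_abs_sub a b
    rw [abs_sub_comm a b, abs_of_pos (sub_pos.mpr hab)] at h2
    have h3 := (abs_lt.mp (h1.trans_le h2)).2
    linarith

lemma abs_arg_eq_arccos {z : ℂ} (hz : z ≠ 0) : |Complex.arg z| = Real.arccos (z.re / ‖z‖) := by
  rw [← Complex.cos_arg hz, ← Real.cos_abs,
    Real.arccos_cos (abs_nonneg _) (Complex.abs_arg_le_pi z)]

lemma bendingMap_norm {η ζ : ℝ} (hζ0 : 0 < ζ) (hζ : ζ < π / 2) (z : ℂ) :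
    ‖bendingMap η ζ z‖ = ‖z‖ := by
  rw [bendingMap_eq hζ0 hζ, norm_mul, Complex.norm_exp_ofReal_mul_I, mul_one]

lemma bendingMap_continuous {η ζ : ℝ} (hζ0 : 0 < ζ) (hζ : ζ < π / 2) :
    Continuous (bendingMap η ζ) := by
  rw [continuous_iff_continuousAt]
  intro z
  by_cases hz : z = 0
  · subst hz
    have h0 : bendingMap η ζ 0 = 0 := by
      rw [bendingMap_eq hζ0 hζ, zero_mul]
    unfold ContinuousAt
    rw [h0, tendsto_zero_iff_norm_tendsto_zero]
    simp only [bendingMap_norm hζ0 hζ]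
    exact tendsto_norm_zero
  · have hc : ContinuousAt (fun z : ℂ =>
        z * Complex.exp ((bendAngle η ζ (Real.arccos (z.re / ‖z‖)) : ℝ) * Complex.I)) z := by
      have h1 : ContinuousAt (fun z : ℂ => z.re / ‖z‖) z :=
        Complex.continuous_re.continuousAt.div continuous_norm.continuousAt (norm_ne_zero_iff.mpr hz)
      have h2 : ContinuousAt (fun z : ℂ => bendAngle η ζ (Real.arccos (z.re / ‖z‖))) z :=
        ((bendAngle_continuous η ζ).comp Real.continuous_arccos).continuousAt.comp h1
      have h3 : ContinuousAt (fun z : ℂ =>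
          ((bendAngle η ζ (Real.arccos (z.re / ‖z‖)) : ℝ) : ℂ)) z :=
        Complex.continuous_ofReal.continuousAt.comp h2
      exact continuousAt_id.mul (h3.mul continuousAt_const).cexp
    refine hc.congr ?_
    filter_upwards [isOpen_ne.mem_nhds hz] with w hw
    rw [bendingMap_eq hζ0 hζ, abs_arg_eq_arccos hw]

lemma bendingMap_polar {η ζ : ℝ} (hζ0 : 0 < ζ) (hζ : ζ < π / 2) (z : ℂ) :
    bendingMap η ζ z =
      ‖z‖ * Complex.exp ((Complex.arg z + bendAngle η ζ |Complex.arg z| : ℝ) * Complex.I) := by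
  rw [bendingMap_eq hζ0 hζ]
  rw [Complex.ofReal_add, add_mul, Complex.exp_add, ← mul_assoc, Complex.norm_mul_exp_arg_mul_I]

lemma bendingMap_arg {η ζ : ℝ} (hζ0 : 0 < ζ) (hζ : ζ < π / 2)
    (hη0 : 0 ≤ η) (hη : η < π - 2 * ζ) {z : ℂ} (hz : z ≠ 0) :
    Complex.arg (bendingMap η ζ z) = Complex.arg z + bendAngle η ζ |Complex.arg z| := by
  rw [bendingMap_polar hζ0 hζ, Complex.arg_real_mul _ (norm_pos_iff.mpr hz),
    Complex.arg_exp_mul_I, toIocMod_eq_self]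
  have h1 := Complex.neg_pi_lt_arg z
  have h2 := bendAngle_nonneg (ζ := ζ) hη0 |Complex.arg z|
  have h3 := (bendArg_strictMono hζ hη0 hη).monotone (Complex.arg_le_pi z)
  simp only [abs_of_pos Real.pi_pos, bendAngle_pi hζ0 hζ] at h3
  constructor <;> linarith

lemma bendingMap_bijective {η ζ : ℝ} (hζ0 : 0 < ζ) (hζ : ζ < π / 2)
    (hη0 : 0 ≤ η) (hη : η < π - 2 * ζ) : Function.Bijective (bendingMap η ζ) := by
  constructor
  · intro z w h
    have hn : ‖z‖ = ‖w‖ := by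
      rw [← bendingMap_norm (η := η) hζ0 hζ z, h, bendingMap_norm hζ0 hζ]
    by_cases hz : z = 0
    · subst hz
      rw [norm_zero] at hn
      exact (norm_eq_zero.mp hn.symm).symm
    · have hw : w ≠ 0 := by
        rw [← norm_ne_zero_iff, ← hn]; exact norm_ne_zero_iff.mpr hz
      refine Complex.ext_norm_arg hn ((bendArg_strictMono hζ hη0 hη).injective ?_)
      rw [← bendingMap_arg hζ0 hζ hη0 hη hz, h, bendingMap_arg hζ0 hζ hη0 hη hw]
  · intro w
    by_cases hw : w = 0
    · exact ⟨0, by rw [bendingMap_eq hζ0 hζ, zero_mul, hw]⟩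
    have hc : Continuous (fun θ : ℝ => θ + bendAngle η ζ |θ|) :=
      continuous_id.add ((bendAngle_continuous η ζ).comp continuous_abs)
    have hmem : Complex.arg w ∈ Set.Ioc ((fun θ : ℝ => θ + bendAngle η ζ |θ|) (-π))
        ((fun θ : ℝ => θ + bendAngle η ζ |θ|) π) := by
      simp only [abs_neg, abs_of_pos Real.pi_pos, bendAngle_pi hζ0 hζ, add_zero]
      exact Complex.arg_mem_Ioc w
    obtain ⟨θ, hθ, he⟩ := intermediate_value_Ioc (by linarith [Real.pi_pos]) hc.continuousOn hmem
    have hwn := norm_pos_iff.mpr hw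
    have ha : Complex.arg ((‖w‖ : ℝ) * Complex.exp (θ * Complex.I)) = θ := by
      rw [Complex.arg_real_mul _ hwn, Complex.arg_exp_mul_I, toIocMod_eq_self]
      constructor <;> linarith [hθ.1, hθ.2]
    have hn : ‖((‖w‖ : ℝ) * Complex.exp (θ * Complex.I) : ℂ)‖ = ‖w‖ := by
      rw [norm_mul, Complex.norm_exp_ofReal_mul_I, mul_one, Complex.norm_real, norm_norm]
    refine ⟨(‖w‖ : ℝ) * Complex.exp (θ * Complex.I), ?_⟩
    rw [bendingMap_polar hζ0 hζ, hn, ha]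
    simp only at he
    rw [he, Complex.norm_mul_exp_arg_mul_I]

/-- For `0 < ζ < π/2` and `0 ≤ η < π − 2ζ`, the bending map
`φ_{η,ζ}` is a homeomorphism of `ℂ` onto itself: continuous, bijective, with
continuous inverse. -/
theorem bendingMap_homeomorph (η ζ : ℝ) (hζ0 : 0 < ζ) (hζ : ζ < π / 2)
    (hη0 : 0 ≤ η) (hη : η < π - 2 * ζ) :
    ∃ e : Homeomorph ℂ ℂ, (e : ℂ → ℂ) = bendingMap η ζ := by
  have hc := bendingMap_continuous (η := η) hζ0 hζ
  have hb := bendingMap_bijective hζ0 hζ hη0 hη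
  have hp : IsProperMap (bendingMap η ζ) := by
    rw [isProperMap_iff_tendsto_cocompact]
    refine ⟨hc, ?_⟩
    rw [← Metric.cobounded_eq_cocompact, ← comap_norm_atTop, Filter.tendsto_comap_iff]
    have : (fun z : ℂ => ‖z‖) ∘ bendingMap η ζ = fun z : ℂ => ‖z‖ := funext (bendingMap_norm hζ0 hζ)
    change Filter.Tendsto ((fun z : ℂ => ‖z‖) ∘ bendingMap η ζ) _ _
    rw [this]
    exact Filter.tendsto_comap
  exact ⟨(Equiv.ofBijective _ hb).toHomeomorphOfContinuousClosed hc hp.isClosedMap, rfl⟩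
end

section
/- For parameters 0 < ζ < π/2 and 0 ≤ η < π − 2ζ, the bending map φ_{η,ζ} maps the closed sector {z ∈ ℂ \ {0} : ζ ≤ arg z ≤ π − ζ} bijectively onto the closed sector {w ∈ ℂ \ {0} : ζ + η ≤ arg w ≤ π − ζ}. -/
open Real

theorem polar_aux {r θ : ℝ} (hr : 0 < r) (h1 : -π < θ) (h2 : θ ≤ π) :
    Complex.arg (r * Complex.exp (θ * Complex.I)) = θ := by
  rw [Complex.exp_mul_I]
  exact Complex.arg_mul_cos_add_sin_mul_I hr ⟨h1, h2⟩

theorem bendingMap_sector_eq (η ζ : ℝ) (hζ0 : 0 < ζ) (hζ : ζ < π / 2) (z : ℂ)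
    (h1 : ζ ≤ Complex.arg z) (h2 : Complex.arg z ≤ π - ζ) :
    bendingMap η ζ z = (‖z‖ : ℂ) * Complex.exp
      ((Complex.arg z + η / (π - 2 * ζ) * (π - ζ - Complex.arg z) : ℝ) * Complex.I) := by
  have hL : π - 2 * ζ ≠ 0 := by linarith
  have key : ∀ a : ℝ, a = η / (π - 2 * ζ) * (π - ζ - Complex.arg z) →
      z * Complex.exp (Complex.I * (a : ℂ)) = (‖z‖ : ℂ) * Complex.exp
      ((Complex.arg z + η / (π - 2 * ζ) * (π - ζ - Complex.arg z) : ℝ) * Complex.I) := by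
    intro a ha
    rw [← ha]
    conv_lhs => rw [← Complex.norm_mul_exp_arg_mul_I z]
    rw [mul_assoc, ← Complex.exp_add]
    congr 2
    push_cast
    ring
  have habs : |Complex.arg z| = Complex.arg z := abs_of_nonneg (by linarith)
  unfold bendingMap
  rw [habs]
  split_ifs with h3 h4 h5
  · have h6 : Complex.arg z = π - ζ := le_antisymm h2 h3
    have := key 0 (by rw [h6]; ring)
    simpa using this
  · have h6 : Complex.arg z = ζ := le_antisymm h4 h1
    apply key
    rw [h6]
    field_simp
    ring
  · apply key
    have e : 1 - (Complex.arg z - ζ) / (π - 2 * ζ)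
        = (π - ζ - Complex.arg z) / (π - 2 * ζ) := by
      rw [eq_div_iff hL, sub_mul, div_mul_cancel₀ _ hL]
      ring
    rw [e]
    ring
  · exact absurd (lt_of_lt_of_le hζ0 h1) h5

/-- The bending map `φ_{η,ζ}` maps the closed sector
`{z ≠ 0 : ζ ≤ arg z ≤ π − ζ}` bijectively onto the closed sector
`{w ≠ 0 : ζ + η ≤ arg w ≤ π − ζ}`. -/
theorem bendingMap_sector_bijOn (η ζ : ℝ) (hζ0 : 0 < ζ) (hζ : ζ < π / 2)
    (hη0 : 0 ≤ η) (hη : η < π - 2 * ζ) :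
    Set.BijOn (bendingMap η ζ)
      {z : ℂ | z ≠ 0 ∧ ζ ≤ Complex.arg z ∧ Complex.arg z ≤ π - ζ}
      {w : ℂ | w ≠ 0 ∧ ζ + η ≤ Complex.arg w ∧ Complex.arg w ≤ π - ζ} := by
  have hL : 0 < π - 2 * ζ := by linarith
  have hpi := Real.pi_pos
  obtain ⟨c, hc⟩ : ∃ c, c = η / (π - 2 * ζ) := ⟨_, rfl⟩
  have hc0 : 0 ≤ c := by rw [hc]; positivity
  have hc1 : c < 1 := by rw [hc, div_lt_one hL]; exact hη
  have hcη : c * (π - 2 * ζ) = η := by rw [hc]; field_simp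
  have lo : ∀ t, ζ ≤ t → ζ + η ≤ t + c * (π - ζ - t) := by
    intro t ht
    nlinarith [mul_nonneg (sub_nonneg.2 ht) (sub_nonneg.2 hc1.le)]
  have hi : ∀ t, t ≤ π - ζ → t + c * (π - ζ - t) ≤ π - ζ := by
    intro t ht
    nlinarith [mul_nonneg (sub_nonneg.2 ht) (sub_nonneg.2 hc1.le)]
  have hnorm : ∀ z : ℂ, ζ ≤ Complex.arg z → Complex.arg z ≤ π - ζ →
      ‖bendingMap η ζ z‖ = ‖z‖ := by
    intro z h1 h2
    rw [bendingMap_sector_eq η ζ hζ0 hζ z h1 h2, norm_mul, Complex.norm_exp_ofReal_mul_I]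
    simp
  have harg : ∀ z : ℂ, z ≠ 0 → ζ ≤ Complex.arg z → Complex.arg z ≤ π - ζ →
      Complex.arg (bendingMap η ζ z) = Complex.arg z + c * (π - ζ - Complex.arg z) := by
    intro z h0 h1 h2
    rw [bendingMap_sector_eq η ζ hζ0 hζ z h1 h2, ← hc]
    have := lo _ h1
    have := hi _ h2
    exact polar_aux (norm_pos_iff.2 h0) (by linarith) (by linarith)
  refine ⟨?_, ?_, ?_⟩
  · rintro z ⟨h0, h1, h2⟩
    refine ⟨?_, ?_, ?_⟩
    · rw [← norm_ne_zero_iff, hnorm z h1 h2]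
      exact norm_ne_zero_iff.2 h0
    · rw [harg z h0 h1 h2]; exact lo _ h1
    · rw [harg z h0 h1 h2]; exact hi _ h2
  · rintro z ⟨h0, h1, h2⟩ w ⟨k0, k1, k2⟩ h
    apply Complex.ext_norm_arg
    · rw [← hnorm z h1 h2, ← hnorm w k1 k2, h]
    · have e := harg z h0 h1 h2
      rw [h, harg w k0 k1 k2] at e
      have e2 : (1 - c) * (Complex.arg z - Complex.arg w) = 0 := by linarith
      rcases mul_eq_zero.1 e2 with e3 | e3 <;> linarith
  · rintro w ⟨h0, h1, h2⟩
    have hd : 0 < 1 - c := by linarith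
    obtain ⟨t, ht⟩ : ∃ t, t = (Complex.arg w - c * (π - ζ)) / (1 - c) := ⟨_, rfl⟩
    have ht' : t * (1 - c) = Complex.arg w - c * (π - ζ) := by rw [ht]; field_simp
    have t1 : ζ ≤ t := by
      rw [ht, le_div_iff₀ hd]; linarith
    have t2 : t ≤ π - ζ := by
      rw [ht, div_le_iff₀ hd]; linarith
    have hn := norm_pos_iff.2 h0
    have ha := polar_aux (θ := t) hn (by linarith) (by linarith)
    obtain ⟨z, hz⟩ : ∃ z : ℂ, z = (‖w‖ : ℂ) * Complex.exp (t * Complex.I) := ⟨_, rfl⟩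
    rw [← hz] at ha
    have hzn : ‖z‖ = ‖w‖ := by
      rw [hz, norm_mul, Complex.norm_exp_ofReal_mul_I]; simp
    have hz0 : z ≠ 0 := by
      rw [← norm_ne_zero_iff, hzn]; exact hn.ne'
    rw [← ha] at t1 t2
    refine ⟨z, ⟨hz0, t1, t2⟩, ?_⟩
    apply Complex.ext_norm_arg
    · rw [hnorm z t1 t2, hzn]
    · rw [harg z hz0 t1 t2, ha]; linarith
end

section
/- Fix 0 < ζ < π/2. Then φ_{0,ζ} is the identity map of ℂ, and the two-variable map (η, z) ↦ φ_{η,ζ}(z) is continuous on [0, π − 2ζ) × ℂ. In particular the bending maps φ_{η,ζ} form a continuous deformation of the identity. -/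
open Real

lemma bendingMap_eq_aux (ζ : ℝ) (hζ0 : 0 < ζ) (hζ : ζ < π / 2) (η : ℝ) (z : ℂ) :
    bendingMap η ζ z = z * Complex.exp (((η * max 0 (min 1
      (1 - (|Complex.arg z| - ζ) / (π - 2 * ζ))) : ℝ) : ℂ) * Complex.I) := by
  have hd : 0 < π - 2 * ζ := by linarith
  unfold bendingMap
  split_ifs with h1 h2 h3
  · have : 1 ≤ (|Complex.arg z| - ζ) / (π - 2 * ζ) := by
      rw [le_div_iff₀ hd]; linarith
    rw [max_eq_left ((min_le_right _ _).trans (by linarith))]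
    simp
  · have : (|Complex.arg z| - ζ) / (π - 2 * ζ) ≤ 0 :=
      div_nonpos_of_nonpos_of_nonneg (by linarith) hd.le
    rw [min_eq_left (by linarith), max_eq_right zero_le_one, mul_one, mul_comm Complex.I]
  all_goals
    have h4 : (|Complex.arg z| - ζ) / (π - 2 * ζ) ≤ 1 := by
      rw [div_le_iff₀ hd]; linarith
    have h5 : 0 ≤ (|Complex.arg z| - ζ) / (π - 2 * ζ) :=
      div_nonneg (by linarith) hd.le
    rw [min_eq_right (by linarith), max_eq_right (by linarith), mul_comm Complex.I]
  · rw [abs_of_pos h3]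
  · rw [abs_of_nonpos (not_lt.mp h3)]
    congr 5
    ring

/-- `φ_{0,ζ}` is the identity map of `ℂ`, and the two-variable
map `(η, z) ↦ φ_{η,ζ}(z)` is continuous on `[0, π − 2ζ) × ℂ`; in particular the
bending maps form a continuous deformation of the identity. -/
theorem bendingMap_continuous_deformation (ζ : ℝ) (hζ0 : 0 < ζ) (hζ : ζ < π / 2) :
    (∀ z : ℂ, bendingMap 0 ζ z = z) ∧
      ContinuousOn (fun p : ℝ × ℂ => bendingMap p.1 ζ p.2)
        (Set.Ico 0 (π - 2 * ζ) ×ˢ (Set.univ : Set ℂ)) := by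
  refine ⟨fun z => by rw [bendingMap_eq_aux ζ hζ0 hζ]; simp, ?_⟩
  apply Continuous.continuousOn
  rw [continuous_iff_continuousAt]
  rintro ⟨η, z⟩
  by_cases hz : z = 0
  · subst hz
    have h0 : bendingMap η ζ 0 = 0 := by rw [bendingMap_eq_aux ζ hζ0 hζ]; simp
    unfold ContinuousAt
    simp only [h0]
    rw [tendsto_zero_iff_norm_tendsto_zero]
    have hn : ∀ p : ℝ × ℂ, ‖bendingMap p.1 ζ p.2‖ = ‖p.2‖ := fun p => by
      rw [bendingMap_eq_aux ζ hζ0 hζ, norm_mul, Complex.norm_exp_ofReal_mul_I, mul_one]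
    simp only [hn]
    have : Continuous fun p : ℝ × ℂ => ‖p.2‖ := by fun_prop
    simpa using this.tendsto (η, (0 : ℂ))
  · have ha : ContinuousAt (fun p : ℝ × ℂ => |Complex.arg p.2|) (η, z) := by
      have h1 : ContinuousAt (fun p : ℝ × ℂ => InnerProductGeometry.angle (1 : ℂ) p.2) (η, z) :=
        ContinuousAt.comp (f := fun p : ℝ × ℂ => ((1 : ℂ), p.2))
          (g := fun y : ℂ × ℂ => InnerProductGeometry.angle y.1 y.2)
          (InnerProductGeometry.continuousAt_angle one_ne_zero hz) (by fun_prop)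
      refine h1.congr ?_
      have : ∀ᶠ p : ℝ × ℂ in nhds (η, z), p.2 ≠ 0 :=
        continuous_snd.continuousAt.eventually_ne hz
      filter_upwards [this] with p hp
      exact Complex.angle_one_left hp
    simp only [bendingMap_eq_aux ζ hζ0 hζ]
    have hm : ContinuousAt (fun p : ℝ × ℂ => p.1 * max 0 (min 1
        (1 - (|Complex.arg p.2| - ζ) / (π - 2 * ζ)))) (η, z) :=
      continuousAt_fst.mul (continuousAt_const.max (continuousAt_const.min
        (continuousAt_const.sub ((ha.sub continuousAt_const).div_const _))))
    exact continuousAt_snd.mul (((Complex.continuous_ofReal.continuousAt.comp hm).mul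
      continuousAt_const).cexp)
end
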